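/- Let s > 0 be real, let λ > s − 1/2 be real, and let ν ≥ 0 be real. Then for every x ∈ (−1,1), applying the right-sided Riemann–Liouville fractional derivative of order s to the function y ↦ (1−y²)^{λ−1/2} · ʳG_ν^{(λ)}(y) yields ( ᴿD₁ˢ [ (1−·²)^{λ−1/2} ʳG_ν^{(λ)} ] )(x) = (2^s Γ(λ+1/2)/Γ(λ−s+1/2)) · (1−x²)^{λ−s−1/2} · ʳG_{ν+s}^{(λ−s)}(x). -/

import Mathlib

open Real

/-- Pochhammer symbol `(a)_n = a (a+1) ⋯ (a+n-1)` for a real base. -/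
noncomputable def poch (a : ℝ) (n : ℕ) : ℝ := ∏ i ∈ Finset.range n, (a + (i : ℝ))

/-- The right generalized Gegenbauer function of fractional degree. -/
noncomputable def rG (lam nu x : ℝ) : ℝ :=
  ∑' j : ℕ, (poch (-nu) j * poch (nu + 2 * lam) j /
    ((j.factorial : ℝ) * poch (lam + 1 / 2) j)) * ((1 - x) / 2) ^ j

/-- The right-sided Riemann–Liouville fractional integral on `(−1,1)`:
`(ₓI₁ˢ u)(x) = (1/Γ(s)) ∫_x^1 (y−x)^{s−1} u(y) dy`. -/
noncomputable def rlInt (s : ℝ) (u : ℝ → ℝ) (x : ℝ) : ℝ :=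
  (1 / Real.Gamma s) * ∫ y in x..1, (y - x) ^ (s - 1) * u y

/-- The right-sided Riemann–Liouville fractional derivative of order `s > 0`:
`(ᴿD₁ˢ u)(x) = (−1)^k (d/dx)^k (ₓI₁^{k−s} u)(x)` with `k = ⌊s⌋ + 1`
(so that `k − 1 ≤ s < k`). -/
noncomputable def rlDeriv (s : ℝ) (u : ℝ → ℝ) (x : ℝ) : ℝ :=
  (-1 : ℝ) ^ (⌊s⌋₊ + 1) * iteratedDeriv (⌊s⌋₊ + 1) (rlInt ((⌊s⌋₊ : ℝ) + 1 - s) u) x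


namespace GGF
open PowerSeries Filter Topology

noncomputable def hc (a b c : ℝ) (n : ℕ) : ℝ := poch a n * poch b n / ((n.factorial : ℝ) * poch c n)

lemma poch_succ (a : ℝ) (n : ℕ) : poch a (n+1) = poch a n * (a + n) := by
  simp [poch, Finset.prod_range_succ]

lemma poch_zero (a : ℝ) : poch a 0 = 1 := by simp [poch]

lemma poch_pos {a : ℝ} (ha : 0 < a) (n : ℕ) : 0 < poch a n := by
  unfold poch
  exact Finset.prod_pos fun i _ => by positivity

lemma hc_zero (a b c : ℝ) : hc a b c 0 = 1 := by simp [hc, poch_zero]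

lemma hc_succ (a b : ℝ) {c : ℝ} (hc' : 0 < c) (n : ℕ) :
    ((n:ℝ)+1) * (n + c) * hc a b c (n+1) = (n + a) * (n + b) * hc a b c n := by
  have h1 := (poch_pos hc' n).ne'
  have h2 : (n.factorial : ℝ) ≠ 0 := by positivity
  have h3 : c + n ≠ 0 := by positivity
  have h4 : (n:ℝ)+1 ≠ 0 := by positivity
  simp only [hc, poch_succ, Nat.factorial_succ]
  push_cast
  field_simp
  ring

lemma coeff_X_d (g : ℝ⟦X⟧) (n : ℕ) : coeff n (X * d⁄dX ℝ g) = n * coeff n g := by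
  cases n with
  | zero => simp
  | succ n => rw [coeff_succ_X_mul, coeff_derivative]; push_cast; ring

lemma coeff_X_X_d (g : ℝ⟦X⟧) (n : ℕ) :
    coeff n (X * (X * d⁄dX ℝ (d⁄dX ℝ g))) = n * (n - 1) * coeff n g := by
  cases n with
  | zero => simp
  | succ n => rw [coeff_succ_X_mul, coeff_X_d, coeff_derivative]; push_cast; ring

lemma coeff_ode (a b c : ℝ) (g : ℝ⟦X⟧) (n : ℕ) :
    coeff n (X * (1 - X) * d⁄dX ℝ (d⁄dX ℝ g) + (C c - C (a + b + 1) * X) * d⁄dX ℝ g - C (a*b) * g)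
      = ((n:ℝ)+1) * (n + c) * coeff (n+1) g - (n + a) * (n + b) * coeff n g := by
  have : X * (1 - X) * d⁄dX ℝ (d⁄dX ℝ g) + (C c - C (a + b + 1) * X) * d⁄dX ℝ g - C (a*b) * g
    = X * d⁄dX ℝ (d⁄dX ℝ g) - X * (X * d⁄dX ℝ (d⁄dX ℝ g)) + C c * d⁄dX ℝ g
      - C (a + b + 1) * (X * d⁄dX ℝ g) - C (a*b) * g := by ring
  rw [this]
  simp only [map_sub, map_add (coeff n), coeff_C_mul, coeff_X_X_d, coeff_X_d, coeff_derivative]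
  ring

noncomputable def bw (p : ℝ) (n : ℕ) : ℝ := poch (-p) n / n.factorial

lemma bw_succ (p : ℝ) (n : ℕ) : ((n:ℝ)+1) * bw p (n+1) = (n - p) * bw p n := by
  have h2 : (n.factorial : ℝ) ≠ 0 := by positivity
  have h4 : (n:ℝ)+1 ≠ 0 := by positivity
  simp only [bw, poch_succ, Nat.factorial_succ]
  push_cast
  field_simp
  ring

lemma bw_ode (p : ℝ) : (1 - X) * d⁄dX ℝ (PowerSeries.mk (bw p)) = - C p * PowerSeries.mk (bw p) := by
  ext n
  rw [sub_mul, one_mul, map_sub, coeff_X_d, coeff_derivative, neg_mul, map_neg, coeff_C_mul]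
  simp only [coeff_mk]
  linear_combination bw_succ p n

lemma euler_formal (a b : ℝ) {c : ℝ} (h : 0 < c) :
    PowerSeries.mk (bw (c - a - b)) * PowerSeries.mk (hc (c-a) (c-b) c) = PowerSeries.mk (hc a b c) := by
  set W := PowerSeries.mk (bw (c - a - b)) with hW
  set F := PowerSeries.mk (hc (c-a) (c-b) c) with hF
  have hWo : (1 - X) * d⁄dX ℝ W = - C (c-a-b) * W := bw_ode _
  have hWo2 : (1 - X) * d⁄dX ℝ (d⁄dX ℝ W) = d⁄dX ℝ W - C (c-a-b) * d⁄dX ℝ W := by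
    have := congrArg (d⁄dX ℝ) hWo
    simp only [Derivation.leibniz, map_sub, map_neg, derivative_C, derivative_X, derivative_one, smul_eq_mul] at this
    simp only [map_sub]
    linear_combination this
  have hFo : X * (1 - X) * d⁄dX ℝ (d⁄dX ℝ F) + (C c - C ((c-a) + (c-b) + 1) * X) * d⁄dX ℝ F
      - C ((c-a)*(c-b)) * F = 0 := by
    ext n
    rw [coeff_ode, hF, coeff_mk, coeff_mk, hc_succ _ _ h]; simp
  have hGo : X * (1 - X) * d⁄dX ℝ (d⁄dX ℝ (W*F)) + (C c - C (a + b + 1) * X) * d⁄dX ℝ (W*F)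
      - C (a*b) * (W*F) = 0 := by
    have hne : (1 - X : ℝ⟦X⟧) ≠ 0 := by
      intro h0
      have := congrArg (coeff 0) h0
      simp at this
    apply (mul_eq_zero.1 (?_ : (1 - X : ℝ⟦X⟧) * _ = 0)).resolve_left hne
    simp only [Derivation.leibniz, map_add, smul_eq_mul]
    simp only [map_sub, map_add, map_mul, map_one] at hWo hWo2 hFo ⊢
    linear_combination (X * F * (1 - X)) * hWo2 + (X * F * (1 - C c + C a + C b)) * hWo
      + (2 * X * (1 - X) * d⁄dX ℝ F) * hWo + ((C c - (C a + C b + 1) * X) * F) * hWo + (W * (1 - X)) * hFo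
  ext n
  rw [coeff_mk]
  induction n with
  | zero => simp [hW, hF, hc_zero, bw, poch_zero]
  | succ n ih =>
    have h1 := congrArg (coeff n) hGo
    rw [coeff_ode, ih, ← hc_succ a b h, map_zero, ← mul_sub] at h1
    have h4 : ((n:ℝ)+1) * (n+c) ≠ 0 := by positivity
    exact sub_eq_zero.1 ((mul_eq_zero.1 h1).resolve_left h4)

lemma summable_ratio {b q : ℕ → ℝ} (hq : Tendsto q atTop (𝓝 1))
    (h : ∀ᶠ n in atTop, b (n+1) = q n * b n) {r : ℝ} (hr : |r| < 1) :
    Summable (fun n => b n * r ^ n) := by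
  obtain ⟨ρ, h1, h2⟩ := exists_between hr
  have ht : Tendsto (fun n => |q n| * |r|) atTop (𝓝 |r|) := by
    simpa using hq.abs.mul_const |r|
  apply summable_of_ratio_norm_eventually_le h2
  filter_upwards [h, ht.eventually_lt_const h1] with n hn hl
  rw [hn, pow_succ]
  simp only [norm_mul, Real.norm_eq_abs]
  calc |q n| * |b n| * (|r^n| * |r|) = (|q n| * |r|) * (|b n| * |r^n|) := by ring
    _ ≤ _ := by gcongr

lemma tendsto_q (a b c d : ℝ) : Tendsto (fun n : ℕ => ((n:ℝ) + a) * (n + b) / ((n + c) * (n + d)))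
    atTop (𝓝 1) := by
  have h1 := tendsto_add_mul_div_add_mul_atTop_nhds a c (1:ℝ) (one_ne_zero)
  have h2 := tendsto_add_mul_div_add_mul_atTop_nhds b d (1:ℝ) (one_ne_zero)
  have := h1.mul h2
  simp only [div_one, mul_one, one_mul] at this
  refine this.congr fun n => ?_
  rw [div_mul_div_comm]
  congr 1 <;> ring

lemma hc_succ' (a b : ℝ) {c : ℝ} (h : 0 < c) (n : ℕ) :
    hc a b c (n+1) = ((n:ℝ) + a) * (n + b) / ((n + 1) * (n + c)) * hc a b c n := by
  have := hc_succ a b h n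
  have h3 : (n:ℝ) + c ≠ 0 := by positivity
  have h4 : (n:ℝ)+1 ≠ 0 := by positivity
  field_simp
  linear_combination this

lemma summable_hc (a b : ℝ) {c : ℝ} (h : 0 < c) {r : ℝ} (hr : |r| < 1) :
    Summable (fun n => hc a b c n * r ^ n) :=
  summable_ratio (tendsto_q a b 1 c) (Eventually.of_forall (hc_succ' a b h)) hr

lemma summable_n_hc (a b : ℝ) {c : ℝ} (h : 0 < c) {r : ℝ} (hr : |r| < 1) :
    Summable (fun n : ℕ => (n * hc a b c n) * r ^ n) := by
  have h1 := (tendsto_q a b 1 c).mul (tendsto_q 1 1 0 1)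
  rw [one_mul] at h1
  refine summable_ratio h1 ?_ hr
  filter_upwards [eventually_ge_atTop 1] with n hn
  rw [hc_succ' a b h]
  have : (n:ℝ) ≠ 0 := by positivity
  have h3 : (n:ℝ) + c ≠ 0 := by positivity
  have h4 : (n:ℝ)+1 ≠ 0 := by positivity
  push_cast
  field_simp
  ring

lemma poch_one (n : ℕ) : poch 1 n = n.factorial := by
  induction n with
  | zero => simp [poch_zero]
  | succ n ih => rw [poch_succ, ih, Nat.factorial_succ]; push_cast; ring

lemma bw_eq (p : ℝ) : bw p = hc (-p) 1 1 := by
  ext n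
  have h2 : (n.factorial : ℝ) ≠ 0 := by positivity
  simp only [bw, hc, poch_one]
  field_simp

lemma choose_eq (p : ℝ) (n : ℕ) : Ring.choose p n = (-1)^n * bw p n := by
  have h2 : (n.factorial : ℝ) ≠ 0 := by positivity
  have h := Ring.descPochhammer_eq_factorial_smul_choose p n
  have h3 : (descPochhammer ℤ n).smeval p = (-1)^n * poch (-p) n := by
    clear h h2
    induction n with
    | zero => simp [poch_zero]
    | succ n ih =>
      rw [descPochhammer_succ_right, Polynomial.smeval_mul, ih, poch_succ, pow_succ]
      simp [Polynomial.smeval_natCast]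
      ring
  rw [h3, nsmul_eq_mul] at h
  simp only [bw]
  field_simp
  linear_combination -h

lemma hasSum_bw (p : ℝ) {t : ℝ} (ht : |t| < 1) : HasSum (fun n => bw p n * t ^ n) ((1 - t) ^ p) := by
  have := (Real.one_add_rpow_hasFPowerSeriesOnBall_zero (a := p)).hasSum (y := -t) (by
    rw [← ENNReal.ofReal_one, Metric.eball_ofReal]; simpa using ht)
  convert! this using 2 with n
  · rw [binomialSeries_apply, choose_eq]
    simp only [List.ofFn_const, List.prod_replicate, smul_eq_mul]
    rw [neg_pow t, mul_mul_mul_comm, mul_comm (bw p n), ← mul_pow]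
    simp [mul_comm]
  · ring

lemma euler (a b : ℝ) {c : ℝ} (h : 0 < c) {t : ℝ} (ht : |t| < 1) :
    ∑' n, hc a b c n * t ^ n = (1 - t) ^ (c - a - b) * ∑' n, hc (c-a) (c-b) c n * t ^ n := by
  rw [← (hasSum_bw _ ht).tsum_eq, tsum_mul_tsum_eq_tsum_sum_antidiagonal_of_summable_norm
    (hasSum_bw _ ht).summable.norm (summable_hc _ _ h ht).norm]
  congr 1; ext n
  have := congrArg (coeff n) (euler_formal a b h)
  rw [coeff_mul, coeff_mk] at this
  rw [← this, Finset.sum_mul]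
  refine Finset.sum_congr rfl fun kl hkl => ?_
  rw [← Finset.HasAntidiagonal.mem_antidiagonal.1 hkl, pow_add, coeff_mk, coeff_mk]
  ring

lemma hasDerivAt_S (a b : ℝ) {c : ℝ} (h : 0 < c) {t : ℝ} (ht : |t| < 1) :
    HasDerivAt (fun t => ∑' n, hc a b c n * t ^ n) (∑' n : ℕ, hc a b c n * (n * t ^ (n-1))) t := by
  obtain ⟨ρ, h1, h2⟩ := exists_between ht
  have h0 : 0 < ρ := (abs_nonneg t).trans_lt h1
  have hs := ((summable_n_hc a b h (r := ρ) (by rwa [abs_of_pos h0])).norm).mul_right ρ⁻¹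
  refine hasDerivAt_tsum_of_isPreconnected (t := Metric.ball 0 ρ) (y₀ := 0)
    (g := fun n t => hc a b c n * t ^ n) (g' := fun n t => hc a b c n * (n * t ^ (n-1))) hs Metric.isOpen_ball
    (convex_ball _ _).isPreconnected ?_ ?_ (by simpa using h0) (summable_hc a b h (by simp)) (by simpa using h1)
  · intro n y _
    exact (hasDerivAt_pow n y).const_mul _
  · intro n y hy
    rcases n with _ | n
    · simp
    have hy' : |y| ≤ ρ := (by simpa using hy : |y| < ρ).le
    simp only [norm_mul, Real.norm_eq_abs, Nat.add_sub_cancel, abs_pow, abs_of_pos h0, pow_succ]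
    calc _ ≤ |hc a b c (n+1)| * (|((n+1:ℕ):ℝ)| * ρ^n) := by gcongr
      _ = _ := by field_simp

lemma poch_shift (d : ℝ) (n : ℕ) : poch (d-1) n * (d - 1 + n) = (d-1) * poch d n := by
  induction n with
  | zero => simp [poch_zero]
  | succ n ih => rw [poch_succ, ih, poch_succ]; push_cast; ring

noncomputable def Hf (A B d T : ℝ) : ℝ := T ^ (d-1) / Real.Gamma d * ∑' n, hc A B d n * T ^ n

lemma hasDerivAt_Hf (A B : ℝ) {d T : ℝ} (hd : 1 < d) (h0 : 0 < T) (h1 : T < 1) :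
    HasDerivAt (Hf A B d) (Hf A B (d-1) T) T := by
  have hT : |T| < 1 := by rwa [abs_of_pos h0]
  have hS := hasDerivAt_S A B (c := d) (by linarith) hT
  have hp : HasDerivAt (fun T : ℝ => T ^ (d-1) / Real.Gamma d) ((d-1) * T^(d-1-1) / Real.Gamma d) T :=
    (Real.hasDerivAt_rpow_const (Or.inl h0.ne')).div_const _
  have hm := hp.mul hS
  have hd1 : 0 < d - 1 := by linarith
  have hG : Real.Gamma d = (d-1) * Real.Gamma (d-1) := by
    rw [← Real.Gamma_add_one hd1.ne']; ring_nf
  have hG0 := (Real.Gamma_pos_of_pos hd1).ne'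
  have key : (d-1) * ∑' n, hc A B (d-1) n * T ^ n =
      (d-1) * (∑' n, hc A B d n * T ^ n) + T * ∑' n : ℕ, hc A B d n * (n * T ^ (n-1)) := by
    have e : ∀ n : ℕ, T * (hc A B d n * (n * T ^ (n-1))) = (n * hc A B d n) * T ^ n := by
      intro n
      rcases n with _ | n
      · simp
      · simp only [Nat.add_sub_cancel, pow_succ]; ring
    rw [← tsum_mul_left, ← tsum_mul_left, ← tsum_mul_left]
    simp_rw [e]
    rw [← Summable.tsum_add ((summable_hc A B (by linarith) hT).mul_left _)
      (summable_n_hc A B (by linarith) hT)]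
    congr 1; ext n
    have p1 := (poch_pos hd1 n).ne'
    have p2 := (poch_pos (a := d) (by linarith) n).ne'
    have h2 : (n.factorial : ℝ) ≠ 0 := by positivity
    have := poch_shift d n
    simp only [hc]
    field_simp
    linear_combination (-(poch A n * poch B n)) * this
  have hpow : T ^ (d-1) = T ^ (d-1-1) * T := by
    rw [Real.rpow_sub_one h0.ne' (d-1)]; field_simp
  refine hm.congr_deriv ?_
  simp only [Hf]
  rw [hG, hpow]
  generalize (∑' n : ℕ, hc A B d n * (n * T ^ (n-1))) = S1 at *
  field_simp
  linear_combination -key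

open MeasureTheory

lemma beta_real {α β a : ℝ} (hα : 0 < α) (hβ : 0 < β) (ha : 0 < a) :
    ∫ z in (0:ℝ)..a, z ^ (α-1) * (a - z) ^ (β-1) =
      a ^ (α+β-1) * (Real.Gamma α * Real.Gamma β / Real.Gamma (α+β)) := by
  have h := Complex.betaIntegral_scaled α β ha
  rw [Complex.betaIntegral_eq_Gamma_mul_div _ _ (by simpa) (by simpa)] at h
  apply Complex.ofReal_injective
  rw [← intervalIntegral.integral_ofReal]
  have e : ∫ z in (0:ℝ)..a, ((z ^ (α-1) * (a - z) ^ (β-1) : ℝ) : ℂ) =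
      ∫ z in (0:ℝ)..a, (z : ℂ) ^ ((α:ℂ) - 1) * ((a : ℂ) - z) ^ ((β:ℂ) - 1) := by
    apply intervalIntegral.integral_congr
    intro z hz
    rw [Set.uIcc_of_le ha.le] at hz
    simp only
    rw [Complex.ofReal_mul, Complex.ofReal_cpow hz.1, Complex.ofReal_cpow (by linarith [hz.2])]
    push_cast; rfl
  rw [e, h]
  push_cast
  rw [Complex.ofReal_cpow ha.le, ← Complex.ofReal_add, Complex.Gamma_ofReal, Complex.Gamma_ofReal, Complex.Gamma_ofReal]
  push_cast; rfl

lemma beta_Ioo {α β x : ℝ} (hα : 0 < α) (hβ : 0 < β) (hx : x < 1) :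
    IntegrableOn (fun y => (y - x) ^ (α-1) * (1 - y) ^ (β-1)) (Set.Ioo x 1) ∧
    ∫ y in Set.Ioo x 1, (y - x) ^ (α-1) * (1 - y) ^ (β-1) =
      (1 - x) ^ (α+β-1) * (Real.Gamma α * Real.Gamma β / Real.Gamma (α+β)) := by
  have h : ∫ y in Set.Ioo x 1, (y - x) ^ (α-1) * (1 - y) ^ (β-1) =
      (1 - x) ^ (α+β-1) * (Real.Gamma α * Real.Gamma β / Real.Gamma (α+β)) := by
    rw [← beta_real hα hβ (by linarith), ← integral_Ioc_eq_integral_Ioo, ← intervalIntegral.integral_of_le hx.le]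
    have := intervalIntegral.integral_comp_sub_right (a := x) (b := 1)
      (fun z : ℝ => z ^ (α-1) * ((1 - x) - z) ^ (β-1)) x
    rw [sub_self] at this
    rw [← this]
    congr 1; ext y; congr 2; ring
  refine ⟨?_, h⟩
  by_contra hn
  have h0 := integral_undef hn
  rw [h] at h0
  have g1 := Real.Gamma_pos_of_pos hα
  have g2 := Real.Gamma_pos_of_pos hβ
  have g3 := Real.Gamma_pos_of_pos (add_pos hα hβ)
  have : 0 < (1 - x) ^ (α+β-1) := Real.rpow_pos_of_pos (by linarith) _
  have : 0 < (1 - x) ^ (α+β-1) * (Real.Gamma α * Real.Gamma β / Real.Gamma (α+β)) := by positivity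
  exact this.ne' h0

lemma Gamma_poch {c : ℝ} (h : 0 < c) (n : ℕ) : Real.Gamma (c + n) = Real.Gamma c * poch c n := by
  induction n with
  | zero => simp [poch_zero]
  | succ n ih =>
    push_cast
    rw [← add_assoc, Real.Gamma_add_one (by positivity), ih, poch_succ]; ring

lemma rlInt_series (A B : ℝ) {α c x : ℝ} (hα : 0 < α) (hc' : 0 < c) (hx : x ∈ Set.Ioo (-1:ℝ) 1)
    (u : ℝ → ℝ) (hu : ∀ y ∈ Set.Ioo (-1:ℝ) 1,
      u y = 4 ^ (c-1) * (((1-y)/2) ^ (c-1) * ∑' n, hc A B c n * ((1-y)/2)^n)) :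
    rlInt α u x = 4 ^ (c-1) * 2 ^ α * Real.Gamma c * Hf A B (c+α) ((1-x)/2) := by
  obtain ⟨hx1, hx2⟩ := hx
  set T := (1-x)/2 with hT
  have hT0 : 0 < T := by rw [hT]; linarith
  have hT1 : |T| < 1 := by rw [abs_of_pos hT0, hT]; linarith
  set K : ℕ → ℝ := fun n => 4 ^ (c-1) * hc A B c n * (2 ^ (c-1))⁻¹ * (2^n)⁻¹ with hK
  set g : ℕ → ℝ → ℝ := fun n y => (y - x) ^ (α-1) * (1 - y) ^ (c+n-1) with hg
  have hb : ∀ n : ℕ, _ := fun n => beta_Ioo (β := c + n) hα (by positivity) hx2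
  have gα := (Real.Gamma_pos_of_pos hα).ne'
  have gc := (Real.Gamma_pos_of_pos hc').ne'
  have gca := (Real.Gamma_pos_of_pos (add_pos hc' hα)).ne'
  have hI : ∀ n, K n * ∫ y in Set.Ioo x 1, g n y =
      (4 ^ (c-1) * 2 ^ α * Real.Gamma c * Real.Gamma α * (T ^ (c + α - 1) / Real.Gamma (c+α))) * (hc A B (c+α) n * T ^ n) := by
    intro n
    rw [hg, (hb n).2]
    have e1 : (1 - x) = 2 * T := by rw [hT]; ring
    rw [show α + (c + n) = c + α + n by ring, Gamma_poch hc', Gamma_poch (add_pos hc' hα), e1,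
      show c + α + n - 1 = c + α - 1 + n by ring, Real.rpow_add_natCast (by positivity),
      Real.mul_rpow (by norm_num) hT0.le, show c + α - 1 = c - 1 + α by ring,
      Real.rpow_add (by norm_num : (0:ℝ) < 2) (c-1) α, mul_pow]
    have p1 := (poch_pos hc' n).ne'
    have p2 := (poch_pos (add_pos hc' hα) n).ne'
    have h2 : (n.factorial : ℝ) ≠ 0 := by positivity
    have h3 : (2:ℝ) ^ (c-1) ≠ 0 := by positivity
    simp only [hK, hc]
    field_simp
  have hgn : ∀ n, ∫ y in Set.Ioo x 1, ‖K n * g n y‖ = ‖K n * ∫ y in Set.Ioo x 1, g n y‖ := by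
    intro n
    have hnn : ∀ y ∈ Set.Ioo x 1, 0 ≤ g n y := fun y hy =>
      mul_nonneg (Real.rpow_nonneg (by linarith [hy.1]) _) (Real.rpow_nonneg (by linarith [hy.2]) _)
    rw [norm_mul, Real.norm_of_nonneg (setIntegral_nonneg measurableSet_Ioo hnn), ← integral_const_mul]
    refine setIntegral_congr_fun measurableSet_Ioo fun y hy => ?_
    simp only [norm_mul]
    rw [Real.norm_of_nonneg (hnn y hy)]
  have hsum := hasSum_integral_of_summable_integral_norm (μ := volume.restrict (Set.Ioo x 1))
    (F := fun n y => K n * g n y) (fun n => (hb n).1.const_mul (K n)) (by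
      simp_rw [hgn, hI]
      exact ((summable_hc A B (add_pos hc' hα) hT1).mul_left _).norm)
  simp only [integral_const_mul, hI] at hsum
  have hsum := hsum.tsum_eq
  rw [tsum_mul_left] at hsum
  have hint : ∫ y in x..1, (y - x) ^ (α-1) * u y = ∫ y in Set.Ioo x 1, ∑' n, K n * g n y := by
    rw [intervalIntegral.integral_of_le hx2.le, integral_Ioc_eq_integral_Ioo]
    refine setIntegral_congr_fun measurableSet_Ioo fun y hy => ?_
    rw [hu y ⟨by linarith [hy.1], hy.2⟩, ← tsum_mul_left, ← tsum_mul_left, ← tsum_mul_left]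
    congr 1; ext n
    have hy1 : 0 < 1 - y := by linarith [hy.2]
    simp only [hK, hg]
    rw [show c + n - 1 = c - 1 + n by ring, Real.rpow_add_natCast hy1.ne', Real.div_rpow hy1.le (by norm_num), div_pow]
    field_simp
  rw [rlInt, hint, ← hsum, Hf]
  field_simp

lemma iter_Hf (A B M D : ℝ) (f : ℝ → ℝ) (hf : ∀ x ∈ Set.Ioo (-1:ℝ) 1, f x = M * Hf A B D ((1-x)/2))
    (k : ℕ) (hk : (k:ℝ) < D) : ∀ x ∈ Set.Ioo (-1:ℝ) 1,
    iteratedDeriv k f x = (-1/2) ^ k * M * Hf A B (D-k) ((1-x)/2) := by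
  induction k with
  | zero => intro x hx; simp [hf x hx]
  | succ k ih =>
    push_cast at hk
    intro x hx
    have ih' := ih (by linarith)
    rw [iteratedDeriv_succ]
    have he : iteratedDeriv k f =ᶠ[𝓝 x] fun x => (-1/2) ^ k * M * Hf A B (D-k) ((1-x)/2) := by
      filter_upwards [Ioo_mem_nhds hx.1 hx.2] with y hy using ih' y hy
    rw [he.deriv_eq]
    have h1 := hasDerivAt_Hf A B (d := D - k) (T := (1-x)/2) (by linarith) (by linarith [hx.2]) (by linarith [hx.1])
    have h2 : HasDerivAt (fun x : ℝ => (1 - x)/2) (-1/2) x := ((hasDerivAt_id x).const_sub 1).div_const 2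
    have h3 := (h1.comp x h2).const_mul ((-1/2) ^ k * M)
    refine h3.deriv.trans ?_
    rw [show D - ((k+1:ℕ):ℝ) = D - k - 1 by push_cast; ring]
    ring

lemma rG_euler (lam nu y : ℝ) (hl : 0 < lam + 1/2) (hy : y ∈ Set.Ioo (-1:ℝ) 1) :
    (1 - y^2) ^ (lam - 1/2) * rG lam nu y = 4 ^ (lam - 1/2) * (((1-y)/2) ^ (lam - 1/2) *
      ∑' n, hc (lam + 1/2 + nu) (1/2 - lam - nu) (lam + 1/2) n * ((1-y)/2)^n) := by
  obtain ⟨h1, h2⟩ := hy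
  have ht : |(1-y)/2| < 1 := by rw [abs_lt]; constructor <;> linarith
  have e := euler (-nu) (nu + 2 * lam) hl ht
  have : rG lam nu y = ∑' n, hc (-nu) (nu + 2 * lam) (lam + 1/2) n * ((1-y)/2)^n := rfl
  rw [this, e, show lam + 1/2 - -nu = lam + 1/2 + nu by ring,
    show lam + 1/2 - (nu + 2*lam) = 1/2 - lam - nu by ring,
    show lam + 1/2 + nu - (nu + 2*lam) = -(lam - 1/2) by ring,
    show 1 - y^2 = 4 * (((1-y)/2) * (1 - (1-y)/2)) by ring,
    Real.mul_rpow (by norm_num) (mul_nonneg (by linarith) (by linarith)),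
    Real.mul_rpow (by linarith) (by linarith), Real.rpow_neg (by linarith)]
  have : (1 - (1-y)/2) ^ (lam - 1/2) ≠ 0 := (Real.rpow_pos_of_pos (by linarith) _).ne'
  generalize (1 - (1-y)/2) ^ (lam - 1/2) = R at *
  field_simp

end GGF

open GGF

theorem ggf_fractional_derivative (s lam nu : ℝ) (hs : 0 < s) (hlam : s - 1 / 2 < lam)
    (hnu : 0 ≤ nu) (x : ℝ) (hx : x ∈ Set.Ioo (-1 : ℝ) 1) :
    rlDeriv s (fun y => (1 - y ^ 2) ^ (lam - 1 / 2) * rG lam nu y) x =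
      2 ^ s * Real.Gamma (lam + 1 / 2) / Real.Gamma (lam - s + 1 / 2) *
        (1 - x ^ 2) ^ (lam - s - 1 / 2) * rG (lam - s) (nu + s) x := by
  have hc1 : 0 < lam + 1/2 := by linarith
  have hc2 : 0 < lam - s + 1/2 := by linarith
  have hfl := Nat.lt_floor_add_one s
  set k := ⌊s⌋₊ with hk
  have hα : 0 < (k:ℝ) + 1 - s := by linarith
  have hint : ∀ x ∈ Set.Ioo (-1:ℝ) 1, rlInt ((k:ℝ) + 1 - s)
      (fun y => (1 - y ^ 2) ^ (lam - 1 / 2) * rG lam nu y) x = _ := fun x hx =>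
    rlInt_series (lam + 1/2 + nu) (1/2 - lam - nu) hα hc1 hx _ (fun y hy => by
      have := rG_euler lam nu y hc1 hy
      rw [show lam + 1/2 - 1 = lam - 1/2 by ring]
      exact this)
  have hit := iter_Hf _ _ _ _ _ hint (k+1) (by push_cast; linarith) x hx
  have hR := rG_euler (lam - s) (nu + s) x hc2 hx
  rw [rlDeriv, ← hk, hit, mul_assoc _ _ (rG _ _ _), hR, Hf]
  have e1 : lam + 1/2 + ((k:ℝ) + 1 - s) - ((k+1 : ℕ):ℝ) = lam - s + 1/2 := by push_cast; ring
  rw [e1, show lam - s + 1/2 + (nu + s) = lam + 1/2 + nu by ring,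
    show 1/2 - (lam - s) - (nu + s) = 1/2 - lam - nu by ring,
    show lam - s + 1/2 - 1 = lam - s - 1/2 by ring, show lam + 1/2 - 1 = lam - 1/2 by ring]
  have h4 : (4:ℝ) ^ (lam - 1/2) = 4 ^ (lam - s - 1/2) * (2 ^ s * 2 ^ s) := by
    rw [← Real.mul_rpow (by norm_num) (by norm_num), show (2:ℝ) * 2 = 4 by norm_num,
      ← Real.rpow_add (by norm_num)]
    congr 1; ring
  have h5 : (2:ℝ) ^ ((k:ℝ) + 1 - s) = 2 ^ (k+1) / 2 ^ s := by
    rw [Real.rpow_sub (by norm_num), ← Real.rpow_natCast]; push_cast; rfl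
  have h6 : (-1:ℝ) ^ (k+1) * (-1/2) ^ (k+1) * 2 ^ (k+1) = 1 := by
    rw [← mul_pow, ← mul_pow]; norm_num
  rw [h4, h5]
  have h7 : (2:ℝ) ^ s ≠ 0 := by positivity
  have h8 := (Real.Gamma_pos_of_pos hc2).ne'
  generalize (∑' n, hc (lam + 1/2 + nu) (1/2 - lam - nu) (lam - s + 1/2) n * ((1-x)/2)^n) = S
  generalize ((1-x)/2) ^ (lam - s - 1/2) = P
  generalize (4:ℝ) ^ (lam - s - 1/2) = Q
  generalize (-1:ℝ) ^ (k+1) = u1 at *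
  generalize (-1/2:ℝ) ^ (k+1) = u2 at *
  generalize (2:ℝ) ^ (k+1) = u3 at *
  generalize Real.Gamma (lam - s + 1/2) = g1 at *
  generalize Real.Gamma (lam + 1/2) = g2 at *
  generalize (2:ℝ) ^ s = w at *
  field_simp
  linear_combination (Q * P * S * g2) * h6
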